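/- arXiv:1906.11969 — 2 statements merged into one kernel-verified Lean document; each statement's English description precedes it below -/
import Mathlib

section
/- Assume the basic parameter conditions δ_L > 0, δ_R > 0, τ_L > δ_L + 1, τ_R < -(δ_R + 1). Then there exists c > 1 such that for every n ≥ 1, every sequence M_0, M_1, …, M_{n-1} of matrices with each M_i ∈ {A_L, A_R}, and every v ∈ Ψ_K, one has ‖M_{n-1}·⋯·M_1·M_0·v‖ ≥ cⁿ·‖v‖. If additionally τ_L > (δ_L + 2)/√2 and τ_R < -(δ_R + 2)/√2, then c can be chosen with c > √2. -/
/-- The Euclidean norm on `Fin 2 → ℝ`. -/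
noncomputable def euclNorm (v : Fin 2 → ℝ) : ℝ := Real.sqrt (v 0 ^ 2 + v 1 ^ 2)

/-- The cone `Ψ_K` of vectors `a • (1, m)` with `m ∈ [qL, qR]`. -/
def coneK (qL qR : ℝ) : Set (Fin 2 → ℝ) :=
  {v | ∃ a m : ℝ, m ∈ Set.Icc qL qR ∧ v = a • ![1, m]}

/-- `applyMats M n v = M_{n-1} ⋯ M_1 M_0 v`. -/
def applyMats (M : ℕ → Matrix (Fin 2) (Fin 2) ℝ) : ℕ → (Fin 2 → ℝ) → Fin 2 → ℝ
  | 0, v => v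
  | n + 1, v => (M n).mulVec (applyMats M n v)

/-- The slope `q` of the unstable direction of `!![τ, 1; -δ, 0]`: it lies in `(-1, 0)` and solves
`q ^ 2 + τ * q + δ = 0`, and `τ + q` is the larger eigenvalue. -/
lemma unstable_slope {τ δ q : ℝ} (hδ : 0 < δ) (hτ : δ + 1 < τ)
    (hq : q = -(τ / 2) * (1 - Real.sqrt (1 - 4 * δ / τ ^ 2))) :
    q ^ 2 + τ * q + δ = 0 ∧ -1 < q ∧ q < 0 ∧ ∀ t, t ^ 2 - τ * t + δ < 0 → t < τ + q := by
  have hτ0 : 0 < τ := by linarith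
  have hdisc : 4 * δ / τ ^ 2 ≤ 1 := by
    rw [div_le_one (by positivity)]
    nlinarith [sq_nonneg (δ - 1)]
  have hr0 := Real.sqrt_nonneg (1 - 4 * δ / τ ^ 2)
  have hr := Real.sq_sqrt (sub_nonneg.2 hdisc)
  set r := Real.sqrt (1 - 4 * δ / τ ^ 2)
  have hτr : τ ^ 2 * r ^ 2 = τ ^ 2 - 4 * δ := by
    rw [hr]
    field_simp
  have hroot : q ^ 2 + τ * q + δ = 0 := by
    rw [hq]
    linear_combination hτr / 4
  have hle : -q ≤ τ + q := by
    rw [hq]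
    nlinarith [mul_nonneg hτ0.le hr0]
  have hlt : ∀ t, t ^ 2 - τ * t + δ < 0 → t < τ + q := by
    intro t ht
    by_contra! h
    nlinarith [mul_nonneg (sub_nonneg.2 h) (sub_nonneg.2 (hle.trans h))]
  have h1 : 1 < τ + q := hlt 1 (by linarith)
  exact ⟨hroot, by nlinarith, by nlinarith, hlt⟩

/-- The bound `c ^ 2` on the squared expansion factor, obtained by concavity from the endpoints
`m = q` and `m = 1`. -/
lemma sq_expansion {τ δ q c m : ℝ} (hroot : q ^ 2 + τ * q + δ = 0) (hc : 1 ≤ c)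
    (hcq : c ≤ τ + q) (hc2 : c ≤ 2) (hq : q < 0) (hqm : q ≤ m) (hm : m ≤ 1) :
    c ^ 2 * (1 + m ^ 2) ≤ (τ + m) ^ 2 + δ ^ 2 := by
  have hδ : δ = -(q * (τ + q)) := by linear_combination hroot
  have hend : 0 ≤ (τ + q) ^ 2 + δ ^ 2 - c ^ 2 * (1 + q ^ 2) := by
    have : 0 ≤ ((τ + q) ^ 2 - c ^ 2) * (1 + q ^ 2) :=
      mul_nonneg (by nlinarith) (by positivity)
    rw [hδ]
    linarith
  have hone : 0 ≤ (τ + 1) ^ 2 + δ ^ 2 - 2 * c ^ 2 := by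
    have : (c + 1) ^ 2 ≤ (τ + 1) ^ 2 := pow_le_pow_left₀ (by linarith) (by linarith) 2
    nlinarith [sq_nonneg δ]
  have hq1 : 0 < 1 - q := by linarith
  have hcc : 0 ≤ c ^ 2 - 1 := by nlinarith
  have key : 0 ≤ (1 - q) * ((τ + m) ^ 2 + δ ^ 2 - c ^ 2 * (1 + m ^ 2)) := by
    have e₁ := mul_nonneg (sub_nonneg.2 hm) hend
    have e₂ := mul_nonneg (sub_nonneg.2 hqm) hone
    have e₃ := mul_nonneg (mul_nonneg hcc hq1.le)
      (mul_nonneg (sub_nonneg.2 hqm) (sub_nonneg.2 hm))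
    linarith
  linarith [nonneg_of_mul_nonneg_right key hq1]

/-- A matrix `!![τ, 1; -δ, 0]` leaves the cone invariant and expands it by `c` as soon as it does
so on the vectors `(1, m)`. -/
lemma cone_step {τ δ l u c : ℝ} (hne : ∀ m ∈ Set.Icc l u, τ + m ≠ 0)
    (hslope : ∀ m ∈ Set.Icc l u, -δ / (τ + m) ∈ Set.Icc l u)
    (hexp : ∀ m ∈ Set.Icc l u, c ^ 2 * (1 + m ^ 2) ≤ (τ + m) ^ 2 + δ ^ 2)
    {v : Fin 2 → ℝ} (hv : v ∈ coneK l u) :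
    (!![τ, 1; -δ, 0]).mulVec v ∈ coneK l u ∧
      c * euclNorm v ≤ euclNorm ((!![τ, 1; -δ, 0]).mulVec v) := by
  obtain ⟨a, m, hm, rfl⟩ := hv
  have hne := hne m hm
  constructor
  · refine ⟨a * (τ + m), _, hslope m hm, ?_⟩
    ext i
    fin_cases i
    · simp [Matrix.mulVec, dotProduct, Fin.sum_univ_two]
      ring
    · simp [Matrix.mulVec, dotProduct, Fin.sum_univ_two]
      field_simp
  · apply Real.le_sqrt_of_sq_le
    have := mul_le_mul_of_nonneg_left (hexp m hm) (sq_nonneg a)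
    rw [euclNorm, mul_pow, Real.sq_sqrt (by positivity)]
    simp [Matrix.mulVec, dotProduct, Fin.sum_univ_two]
    linarith

/-- If all `M i`, `i < n`, preserve a set and expand its vectors by `c`, then their product
expands by `c ^ n`. -/
lemma applyMats_expansion {S : Set (Fin 2 → ℝ)} {c : ℝ} (hc : 0 ≤ c)
    {M : ℕ → Matrix (Fin 2) (Fin 2) ℝ} {v : Fin 2 → ℝ} (hv : v ∈ S) (n : ℕ)
    (hM : ∀ i < n, ∀ w ∈ S, (M i).mulVec w ∈ S ∧ c * euclNorm w ≤ euclNorm ((M i).mulVec w)) :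
    applyMats M n v ∈ S ∧ c ^ n * euclNorm v ≤ euclNorm (applyMats M n v) := by
  induction n with
  | zero => simpa [applyMats] using hv
  | succ n ih =>
    obtain ⟨hS, hle⟩ := ih fun i hi => hM i (hi.trans n.lt_succ_self)
    obtain ⟨hS', hle'⟩ := hM n n.lt_succ_self _ hS
    refine ⟨hS', ?_⟩
    calc c ^ (n + 1) * euclNorm v = c * (c ^ n * euclNorm v) := by ring
      _ ≤ c * euclNorm (applyMats M n v) := mul_le_mul_of_nonneg_left hle hc
      _ ≤ _ := hle'

/-- Uniform expansion with some `c > b`, given that `b` lies between the eigenvalues of `A_L` and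
that `-b` lies between those of `A_R`. -/
lemma exists_expansion {τL δL τR δR qL qR b : ℝ}
    (hδL : 0 < δL) (hδR : 0 < δR)
    (hτL : τL > δL + 1) (hτR : τR < -(δR + 1))
    (hqL : qL = -(τL / 2) * (1 - Real.sqrt (1 - 4 * δL / τL ^ 2)))
    (hqR : qR = -(τR / 2) * (1 - Real.sqrt (1 - 4 * δR / τR ^ 2)))
    (hb : 1 ≤ b) (hbL : b ^ 2 - τL * b + δL < 0) (hbR : b ^ 2 + τR * b + δR < 0)
    (hb2 : b < 2) :
    ∃ c > b, ∀ n : ℕ, 1 ≤ n → ∀ M : ℕ → Matrix (Fin 2) (Fin 2) ℝ,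
      (∀ i < n, M i = !![τL, 1; -δL, 0] ∨ M i = !![τR, 1; -δR, 0]) → ∀ v ∈ coneK qL qR,
        euclNorm (applyMats M n v) ≥ c ^ n * euclNorm v := by
  obtain ⟨hrL, hL1, hL0, hLlt⟩ := unstable_slope hδL hτL hqL
  obtain ⟨hrR, hR1, hR0, hRlt⟩ := unstable_slope (τ := -τR) (q := -qR) hδR (by linarith)
    (by rw [hqR, neg_sq]; ring)
  have hL := hLlt b hbL
  have hR := hRlt b (by linarith)
  obtain ⟨c, hbc, hc⟩ := exists_between (lt_min (lt_min hL hR) hb2)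
  obtain ⟨⟨hcL, hcR⟩, hc2⟩ : (c < τL + qL ∧ c < -τR + -qR) ∧ c < 2 := by
    simpa only [lt_min_iff] using hc
  refine ⟨c, hbc, fun n _ M hM v hv => (applyMats_expansion (by linarith) hv n ?_).2⟩
  intro i hi w hw
  rcases hM i hi with h | h <;> rw [h] <;> refine cone_step ?_ ?_ ?_ hw
  · rintro m ⟨hm, -⟩
    linarith
  · rintro m ⟨hm, -⟩
    have hpos : 0 < τL + m := by linarith
    refine ⟨(le_div_iff₀ hpos).2 (by nlinarith), ?_⟩
    exact (div_nonpos_of_nonpos_of_nonneg (by linarith) hpos.le).trans (by linarith)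
  · rintro m ⟨hm, hm'⟩
    exact sq_expansion hrL (by linarith) hcL.le hc2.le hL0 hm (by linarith)
  · rintro m ⟨-, hm⟩
    linarith
  · rintro m ⟨-, hm⟩
    have hneg : τR + m < 0 := by linarith
    refine ⟨?_, (div_le_iff_of_neg hneg).2 (by nlinarith)⟩
    exact hL0.le.trans (div_nonneg_of_nonpos (by linarith) hneg.le)
  · rintro m ⟨hm', hm⟩
    have := sq_expansion (m := -m) hrR (by linarith) hcR.le hc2.le hR0 (by linarith) (by linarith)
    linarith

/-- there exists `c > 1` such that any product of `n` matrices
from `{A_L, A_R}` expands every vector of `Ψ_K` by at least `cⁿ`; under the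
additional conditions `c` may be chosen greater than `√2`. -/
theorem stmt10 (τL δL τR δR qL qR : ℝ)
    (hδL : 0 < δL) (hδR : 0 < δR)
    (hτL : τL > δL + 1) (hτR : τR < -(δR + 1))
    (AL AR : Matrix (Fin 2) (Fin 2) ℝ)
    (hAL : AL = !![τL, 1; -δL, 0]) (hAR : AR = !![τR, 1; -δR, 0])
    (hqL : qL = -(τL / 2) * (1 - Real.sqrt (1 - 4 * δL / τL ^ 2)))
    (hqR : qR = -(τR / 2) * (1 - Real.sqrt (1 - 4 * δR / τR ^ 2))) :
    (∃ c > 1, ∀ n : ℕ, 1 ≤ n → ∀ M : ℕ → Matrix (Fin 2) (Fin 2) ℝ,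
      (∀ i < n, M i = AL ∨ M i = AR) → ∀ v ∈ coneK qL qR,
        euclNorm (applyMats M n v) ≥ c ^ n * euclNorm v) ∧
    (τL > (δL + 2) / Real.sqrt 2 → τR < -((δR + 2) / Real.sqrt 2) →
      ∃ c > Real.sqrt 2, ∀ n : ℕ, 1 ≤ n → ∀ M : ℕ → Matrix (Fin 2) (Fin 2) ℝ,
        (∀ i < n, M i = AL ∨ M i = AR) → ∀ v ∈ coneK qL qR,
          euclNorm (applyMats M n v) ≥ c ^ n * euclNorm v) := by
  subst hAL hAR
  refine ⟨exists_expansion hδL hδR hτL hτR hqL hqR le_rfl (by linarith) (by linarith)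
    (by norm_num), fun hL hR => ?_⟩
  have hs : Real.sqrt 2 ^ 2 = 2 := Real.sq_sqrt (by norm_num)
  have hs0 : 0 < Real.sqrt 2 := by positivity
  have hL' := (div_lt_iff₀ hs0).1 hL
  have hR' := (div_lt_iff₀ hs0).1 (lt_neg_of_lt_neg hR)
  exact exists_expansion hδL hδR hτL hτR hqL hqR (by nlinarith) (by linarith) (by linarith)
    (by nlinarith)
end

section
/- Assume the basic parameter conditions δ_L > 0, δ_R > 0, τ_L > δ_L + 1, τ_R < -(δ_R + 1), the additional conditions τ_L > (δ_L + 2)/√2 and τ_R < -(δ_R + 2)/√2, and φ > 0. Let α ⊆ Ω be a nondegenerate line segment whose slope lies in K = [q_L, q_R]. Then there exist an integer n ≥ 1, a point P with first coordinate 0, and a point Q with second coordinate 0, such that the segment from P to Q is contained in f^n(α). -/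
/-- The 2D border-collision normal form. -/
noncomputable def bcnf (τL δL τR δR : ℝ) (p : ℝ × ℝ) : ℝ × ℝ :=
  if p.1 ≤ 0 then (τL * p.1 + p.2 + 1, -δL * p.1)
  else (τR * p.1 + p.2 + 1, -δR * p.1)

open Set

section Branches

variable {τL δL τR δR : ℝ} {p q : ℝ × ℝ}

lemma bcnf_of_nonpos (h : p.1 ≤ 0) :
    bcnf τL δL τR δR p = (τL * p.1 + p.2 + 1, -δL * p.1) := by
  simp [bcnf, h]

lemma bcnf_of_nonneg (h : 0 ≤ p.1) :
    bcnf τL δL τR δR p = (τR * p.1 + p.2 + 1, -δR * p.1) := by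
  rcases h.eq_or_lt with h | h
  · simp [bcnf, ← h]
  · simp [bcnf, not_le.2 h]

/-- On either side of the switching line the map is affine. -/
lemma segment_bcnf_subset_image (h : (p.1 ≤ 0 ∧ q.1 ≤ 0) ∨ (0 ≤ p.1 ∧ 0 ≤ q.1)) :
    segment ℝ (bcnf τL δL τR δR p) (bcnf τL δL τR δR q) ⊆
      bcnf τL δL τR δR '' segment ℝ p q := by
  rintro _ ⟨a, b, ha, hb, hab, rfl⟩
  refine ⟨a • p + b • q, ⟨a, b, ha, hb, hab, rfl⟩, ?_⟩
  rcases h with ⟨hp, hq⟩ | ⟨hp, hq⟩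
  · have h : (a • p + b • q).1 ≤ 0 := by
      simp only [Prod.fst_add, Prod.smul_fst, smul_eq_mul]
      nlinarith
    rw [bcnf_of_nonpos hp, bcnf_of_nonpos hq, bcnf_of_nonpos h]
    ext
    · simp
      linear_combination -hab
    · simp
      ring
  · have h : 0 ≤ (a • p + b • q).1 := by
      simp only [Prod.fst_add, Prod.smul_fst, smul_eq_mul]
      positivity
    rw [bcnf_of_nonneg hp, bcnf_of_nonneg hq, bcnf_of_nonneg h]
    ext
    · simp
      linear_combination -hab
    · simp
      ring

end Branches

/-- `p` and `q` are the endpoints of a nondegenerate segment in `T` with slope in `[a, b]`. -/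
def IsConeSegment (T : Set (ℝ × ℝ)) (a b : ℝ) (p q : ℝ × ℝ) : Prop :=
  p ∈ T ∧ q ∈ T ∧ p.1 ≠ q.1 ∧ ∃ m ∈ Icc a b, q.2 - p.2 = m * (q.1 - p.1)

/-- Some forward image of the segment contains a segment joining the two coordinate axes. -/
def ReachesAxes (f : ℝ × ℝ → ℝ × ℝ) (p q : ℝ × ℝ) : Prop :=
  ∃ n : ℕ, 1 ≤ n ∧ ∃ P Q : ℝ × ℝ, P.1 = 0 ∧ Q.2 = 0 ∧ segment ℝ P Q ⊆ f^[n] '' segment ℝ p q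

section General

variable {T : Set (ℝ × ℝ)} {a b : ℝ} {p q p' q' : ℝ × ℝ} {f : ℝ × ℝ → ℝ × ℝ}

lemma IsConeSegment.symm (h : IsConeSegment T a b p q) : IsConeSegment T a b q p := by
  obtain ⟨hp, hq, hne, m, hm, hpq⟩ := h
  exact ⟨hq, hp, hne.symm, m, hm, by linear_combination -hpq⟩

lemma ReachesAxes.symm (h : ReachesAxes f p q) : ReachesAxes f q p := by
  simpa only [ReachesAxes, segment_symm ℝ q p] using h

lemma ReachesAxes.of_subset {n : ℕ} (h : ReachesAxes f p' q')
    (hsub : segment ℝ p' q' ⊆ f^[n] '' segment ℝ p q) : ReachesAxes f p q := by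
  obtain ⟨k, hk, P, Q, hP, hQ, hPQ⟩ := h
  refine ⟨k + n, by omega, P, Q, hP, hQ, hPQ.trans ?_⟩
  rw [Function.iterate_add, image_comp]
  exact image_mono hsub

lemma exists_mem_segment_fst_eq_zero
    (h : ¬((p.1 ≤ 0 ∧ q.1 ≤ 0) ∨ (0 ≤ p.1 ∧ 0 ≤ q.1))) : ∃ z ∈ segment ℝ p q, z.1 = 0 := by
  wlog hp : p.1 ≤ 0 generalizing p q
  · rw [segment_symm]
    exact this (by tauto) (by grind)
  have hq : 0 < q.1 := by grind
  have hd : 0 < q.1 - p.1 := by linarith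
  refine ⟨(q.1 / (q.1 - p.1)) • p + (-p.1 / (q.1 - p.1)) • q,
    ⟨_, _, by positivity, div_nonneg (by linarith) hd.le, by field_simp; ring, rfl⟩, ?_⟩
  simp
  field_simp
  ring

lemma IsConeSegment.left_of_mem_segment (hT : Convex ℝ T) (h : IsConeSegment T a b p q)
    {z : ℝ × ℝ} (hz : z ∈ segment ℝ p q) (hne : p.1 ≠ z.1) : IsConeSegment T a b p z := by
  obtain ⟨hp, hq, -, m, hm, hpq⟩ := h
  refine ⟨hp, hT.segment_subset hp hq hz, hne, m, hm, ?_⟩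
  obtain ⟨s, t, -, -, hst, rfl⟩ := hz
  simp
  linear_combination t * hpq + (p.2 - m * p.1) * hst

end General

section Expansion

variable {τL δL τR δR a b c : ℝ} {T : Set (ℝ × ℝ)} {p q : ℝ × ℝ}

/-- The cone `[a, b]` of slopes is forward invariant, and both branches expand its vectors
horizontally by a factor of at least `c`. -/
structure IsExpandingCone (τL δL τR δR a b c : ℝ) : Prop where
  left : ∀ m ∈ Icc a b, c ≤ τL + m ∧ -δL / (τL + m) ∈ Icc a b
  right : ∀ m ∈ Icc a b, c ≤ -(τR + m) ∧ -δR / (τR + m) ∈ Icc a b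
  pos : 0 < c

lemma IsConeSegment.image (hK : IsExpandingCone τL δL τR δR a b c)
    (hT : MapsTo (bcnf τL δL τR δR) T T) (h : IsConeSegment T a b p q)
    (hside : (p.1 ≤ 0 ∧ q.1 ≤ 0) ∨ (0 ≤ p.1 ∧ 0 ≤ q.1)) :
    IsConeSegment T a b (bcnf τL δL τR δR p) (bcnf τL δL τR δR q) ∧
      c * |q.1 - p.1| ≤ |(bcnf τL δL τR δR q).1 - (bcnf τL δL τR δR p).1| := by
  obtain ⟨hp, hq, hne, m, hm, hpq⟩ := h
  have hc := hK.pos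
  obtain ⟨τ, δ, hfp, hfq, hcm, hm'⟩ : ∃ τ δ : ℝ,
      bcnf τL δL τR δR p = (τ * p.1 + p.2 + 1, -δ * p.1) ∧
      bcnf τL δL τR δR q = (τ * q.1 + q.2 + 1, -δ * q.1) ∧
      c ≤ |τ + m| ∧ -δ / (τ + m) ∈ Icc a b := by
    rcases hside with ⟨hp0, hq0⟩ | ⟨hp0, hq0⟩
    · exact ⟨τL, δL, bcnf_of_nonpos hp0, bcnf_of_nonpos hq0,
        (hK.left m hm).1.trans (le_abs_self _), (hK.left m hm).2⟩
    · exact ⟨τR, δR, bcnf_of_nonneg hp0, bcnf_of_nonneg hq0,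
        (hK.right m hm).1.trans (neg_le_abs _), (hK.right m hm).2⟩
  have hτm : τ + m ≠ 0 := abs_pos.1 (hc.trans_le hcm)
  have hx : (bcnf τL δL τR δR q).1 - (bcnf τL δL τR δR p).1 =
      (τ + m) * (q.1 - p.1) := by
    rw [hfp, hfq]
    linear_combination hpq
  refine ⟨⟨hT hp, hT hq, ?_, _, hm', ?_⟩, ?_⟩
  · rw [ne_comm, ← sub_ne_zero, hx]
    exact mul_ne_zero hτm (sub_ne_zero.2 hne.symm)
  · rw [hx, hfp, hfq]
    field_simp
    ring
  · rw [hx, abs_mul]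
    gcongr

/-- A segment with one end on the switching line either grows by a factor `c ^ 2` over two
iterates, or its first image already joins the coordinate axes. -/
lemma IsConeSegment.reachesAxes_or_grows_of_fst_eq_zero
    (hK : IsExpandingCone τL δL τR δR a b c) (hT : MapsTo (bcnf τL δL τR δR) T T)
    (h : IsConeSegment T a b p q) (hq : q.1 = 0) :
    ReachesAxes (bcnf τL δL τR δR) p q ∨ ∃ n : ℕ, ∃ p' q' : ℝ × ℝ,
      IsConeSegment T a b p' q' ∧
      segment ℝ p' q' ⊆ (bcnf τL δL τR δR)^[n] '' segment ℝ p q ∧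
      c ^ 2 * |q.1 - p.1| ≤ |q'.1 - p'.1| := by
  set f := bcnf τL δL τR δR with hf
  have hside : (p.1 ≤ 0 ∧ q.1 ≤ 0) ∨ (0 ≤ p.1 ∧ 0 ≤ q.1) := by
    rcases le_total p.1 0 with hp | hp
    · exact Or.inl ⟨hp, hq.le⟩
    · exact Or.inr ⟨hp, hq.ge⟩
  obtain ⟨h₁, hw₁⟩ := h.image hK hT hside
  have himg : segment ℝ (f p) (f q) ⊆ f '' segment ℝ p q := segment_bcnf_subset_image hside
  by_cases hside' : ((f p).1 ≤ 0 ∧ (f q).1 ≤ 0) ∨ (0 ≤ (f p).1 ∧ 0 ≤ (f q).1)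
  · right
    obtain ⟨h₂, hw₂⟩ := h₁.image hK hT hside'
    refine ⟨2, _, _, h₂, ?_, ?_⟩
    · refine (segment_bcnf_subset_image hside').trans ?_
      rw [Function.iterate_succ, Function.iterate_one, image_comp]
      exact image_mono himg
    · refine le_trans ?_ hw₂
      rw [sq, mul_assoc]
      exact mul_le_mul_of_nonneg_left hw₁ hK.pos.le
  · left
    have hfq : (f q).2 = 0 := by simp [hf, bcnf_of_nonpos hq.le, hq]
    obtain ⟨z, hz, hz0⟩ : ∃ z ∈ segment ℝ (f p) (f q), z.1 = 0 :=
      exists_mem_segment_fst_eq_zero hside'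
    refine ⟨1, le_rfl, z, f q, hz0, hfq, ?_⟩
    rw [Function.iterate_one]
    exact ((convex_segment _ _).segment_subset hz (right_mem_segment ℝ _ _)).trans himg

lemma IsConeSegment.reachesAxes_or_grows (hK : IsExpandingCone τL δL τR δR a b c)
    (hc : c ≤ 2) (hT : MapsTo (bcnf τL δL τR δR) T T) (hTc : Convex ℝ T)
    (h : IsConeSegment T a b p q) :
    ReachesAxes (bcnf τL δL τR δR) p q ∨ ∃ n : ℕ, ∃ p' q' : ℝ × ℝ,
      IsConeSegment T a b p' q' ∧
      segment ℝ p' q' ⊆ (bcnf τL δL τR δR)^[n] '' segment ℝ p q ∧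
      c ^ 2 / 2 * |q.1 - p.1| ≤ |q'.1 - p'.1| := by
  have hc0 := hK.pos
  by_cases hside : (p.1 ≤ 0 ∧ q.1 ≤ 0) ∨ (0 ≤ p.1 ∧ 0 ≤ q.1)
  · right
    obtain ⟨h₁, hw₁⟩ := h.image hK hT hside
    refine ⟨1, _, _, h₁, segment_bcnf_subset_image hside, le_trans ?_ hw₁⟩
    gcongr
    nlinarith
  obtain ⟨z, hz, hz0⟩ : ∃ z ∈ segment ℝ p q, z.1 = 0 :=
    exists_mem_segment_fst_eq_zero hside
  wlog hhalf : |q.1 - p.1| ≤ 2 * |z.1 - p.1| generalizing p q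
  · have := this h.symm (by tauto) (by rwa [segment_symm]) (by
      have := abs_add_le (q.1 - z.1) (z.1 - p.1)
      rw [sub_add_sub_cancel] at this
      rw [abs_sub_comm p.1 q.1, abs_sub_comm z.1 q.1]
      linarith)
    rw [segment_symm, abs_sub_comm] at this
    exact this.imp_left ReachesAxes.symm
  have hne : p.1 ≠ z.1 := by
    rintro he
    rw [he, sub_self, abs_zero, mul_zero, ← he] at hhalf
    exact h.2.2.1 (sub_eq_zero.1 (abs_nonpos_iff.1 hhalf)).symm
  have hsub : segment ℝ p z ⊆ segment ℝ p q :=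
    (convex_segment _ _).segment_subset (left_mem_segment ℝ _ _) hz
  rcases (h.left_of_mem_segment hTc hz hne).reachesAxes_or_grows_of_fst_eq_zero hK hT hz0 with
    hr | ⟨n, p', q', h', hs, hw⟩
  · exact Or.inl (hr.of_subset (n := 0) (by simpa using hsub))
  · refine Or.inr ⟨n, p', q', h', hs.trans (image_mono hsub), le_trans ?_ hw⟩
    nlinarith [sq_nonneg c]

lemma IsConeSegment.reachesAxes (hK : IsExpandingCone τL δL τR δR a b c)
    (hc : c ≤ 2) (hc2 : 2 < c ^ 2) (hT : MapsTo (bcnf τL δL τR δR) T T)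
    (hTc : Convex ℝ T) {M : ℝ} (hM : ∀ p ∈ T, ∀ q ∈ T, |q.1 - p.1| ≤ M)
    (h : IsConeSegment T a b p q) :
    ReachesAxes (bcnf τL δL τR δR) p q := by
  by_contra hr
  have key : ∀ k : ℕ, ∃ n : ℕ, ∃ p' q' : ℝ × ℝ, IsConeSegment T a b p' q' ∧
      segment ℝ p' q' ⊆ (bcnf τL δL τR δR)^[n] '' segment ℝ p q ∧
      (c ^ 2 / 2) ^ k * |q.1 - p.1| ≤ |q'.1 - p'.1| := by
    intro k
    induction k with
    | zero => exact ⟨0, p, q, h, by simp, by simp⟩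
    | succ k ih =>
      obtain ⟨n, p', q', h', hs, hw⟩ := ih
      rcases h'.reachesAxes_or_grows hK hc hT hTc with hr' | ⟨j, p'', q'', h'', hs', hw'⟩
      · exact absurd (hr'.of_subset hs) hr
      · refine ⟨j + n, p'', q'', h'', hs'.trans ?_, le_trans ?_ hw'⟩
        · rw [Function.iterate_add, image_comp]
          exact image_mono hs
        · rw [pow_succ', mul_assoc]
          gcongr
  have hw : 0 < |q.1 - p.1| := abs_pos.2 (sub_ne_zero.2 h.2.2.1.symm)
  obtain ⟨k, hk⟩ := pow_unbounded_of_one_lt (M / |q.1 - p.1|) (by linarith : 1 < c ^ 2 / 2)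
  obtain ⟨-, p', q', h', -, hw'⟩ := key k
  rw [div_lt_iff₀ hw] at hk
  linarith [hM p' h'.1 q' h'.2.1]

end Expansion

/-- The roots `s < u` of `t ^ 2 - τ * t + δ`. -/
lemma quadratic_roots_bounds {τ δ s u : ℝ} (hδ : 0 < δ) (hτ : δ + 1 < τ)
    (hτ2 : (δ + 2) / √2 < τ) (hs : s = (τ - √(τ ^ 2 - 4 * δ)) / 2)
    (hu : u = (τ + √(τ ^ 2 - 4 * δ)) / 2) :
    s + u = τ ∧ s * u = δ ∧ 0 < s ∧ s < 1 ∧ √2 < u := by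
  have hdisc : 0 < τ ^ 2 - 4 * δ := by nlinarith [sq_nonneg (δ - 1)]
  have hsq := Real.sq_sqrt hdisc.le
  have hlt : s < u := by
    rw [hs, hu]
    linarith [Real.sqrt_pos.2 hdisc]
  have hadd : s + u = τ := by rw [hs, hu]; ring
  have hmul : s * u = δ := by rw [hs, hu]; linear_combination -hsq / 4
  have hr := Real.sq_sqrt (zero_le_two (α := ℝ))
  have hr0 : 0 < √(2 : ℝ) := by positivity
  rw [div_lt_iff₀ hr0] at hτ2
  refine ⟨hadd, hmul, ?_, ?_, ?_⟩
  · by_contra! h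
    nlinarith
  · by_contra! h
    nlinarith
  · by_contra! h
    nlinarith

/-- The triangle cut out by the unstable line of the left fixed point, its image under the right
branch, and a line parallel to the stable direction. -/
def trappingTriangle (s u d k c : ℝ) : Set (ℝ × ℝ) :=
  {p | s * p.1 + p.2 ≤ s * d ∧ c ≤ u * p.1 + p.2 ∧ k * (p.1 - d) ≤ p.2}

section Trapping

variable {s u d k c : ℝ}

lemma convex_trappingTriangle : Convex ℝ (trappingTriangle s u d k c) := by
  rintro p ⟨hp₁, hp₂, hp₃⟩ q ⟨hq₁, hq₂, hq₃⟩ a b ha hb hab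
  obtain rfl : b = 1 - a := by linarith
  refine ⟨?_, ?_, ?_⟩ <;> simp only [Prod.fst_add, Prod.snd_add, Prod.smul_fst, Prod.smul_snd,
    smul_eq_mul]
  · nlinarith
  · nlinarith
  · nlinarith

lemma fst_mem_Icc_of_mem_trappingTriangle (hs : 0 < s) (hu : s < u) (hk : 0 < k) {p : ℝ × ℝ}
    (hp : p ∈ trappingTriangle s u d k c) : p.1 ∈ Icc ((c - s * d) / (u - s)) d := by
  obtain ⟨h₁, h₂, h₃⟩ := hp
  constructor
  · rw [div_le_iff₀ (sub_pos.2 hu)]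
    linarith
  · by_contra! h
    nlinarith

lemma mapsTo_bcnf_trappingTriangle {δR τR : ℝ} (hs : 0 < s) (hu : 1 < u) (hsu : s < u)
    (hδR : 0 < δR) (hτR : τR < -1) (hd : d * (1 - s) = 1) (hd1 : 1 ≤ d) (hk : k * (s - τR) = δR)
    (hc : c = u * (τR * d + 1) - δR * d) (hc0 : 0 ≤ c * (u - 1) + u) :
    MapsTo (bcnf (s + u) (s * u) τR δR) (trappingTriangle s u d k c)
      (trappingTriangle s u d k c) := by
  have hk0 : 0 < k := by
    by_contra! h
    nlinarith
  intro p hp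
  have hpd := (fst_mem_Icc_of_mem_trappingTriangle hs hsu hk0 hp).2
  obtain ⟨h₁, h₂, h₃⟩ := hp
  rcases le_total p.1 0 with hp0 | hp0
  · rw [bcnf_of_nonpos hp0]
    refine ⟨?_, ?_, ?_⟩ <;> dsimp only
    · nlinarith
    · nlinarith
    · have : (s + u) * p.1 + p.2 + 1 ≤ d := by nlinarith
      have : k * ((s + u) * p.1 + p.2 + 1 - d) ≤ 0 := by nlinarith
      have : 0 ≤ -(s * u) * p.1 := by nlinarith [mul_pos hs (zero_lt_one.trans hu)]
      linarith
  · rw [bcnf_of_nonneg hp0]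
    refine ⟨?_, ?_, ?_⟩ <;> dsimp only
    · have : s * (τR * p.1 + p.2 + 1) ≤ s * (τR * p.1 + (s * d - s * p.1) + 1) := by
        gcongr
        linarith
      nlinarith [mul_nonneg hp0 hs.le, mul_nonneg hp0 hδR.le]
    · -- the bound is affine in `p.1`, so it suffices to check it at `0` and at `d`
      have hV : c ≤ u * (1 - k * d) := by
        have : c ≤ -(k * d) := by
          have h1 : τR * d + 1 < 0 := by nlinarith
          have h2 : -(δR * d) = k * (τR * d + 1 - d) := by
            linear_combination d * hk + k * hd
          nlinarith
        nlinarith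
      have hlow : u * (τR * p.1 + k * (p.1 - d) + 1) - δR * p.1 ≤
          u * (τR * p.1 + p.2 + 1) + -δR * p.1 := by
        nlinarith
      refine le_trans ?_ hlow
      have hd0 : 0 < d := by linarith
      refine le_of_mul_le_mul_left ?_ hd0
      have h1 := mul_le_mul_of_nonneg_left hV (sub_nonneg.2 hpd)
      have h2 : d * (u * (τR * p.1 + k * (p.1 - d) + 1) - δR * p.1) =
          (d - p.1) * (u * (1 - k * d)) + p.1 * c := by
        rw [hc]
        ring
      linarith
    · have : k * p.2 ≤ k * (s * d - s * p.1) := by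
        gcongr
        linarith
      nlinarith

end Trapping

/-- any nondegenerate line segment `α ⊆ Ω` with slope in
`K = [q_L, q_R]` has an iterate `fⁿ(α)` containing a segment from a point `P`
on `x = 0` to a point `Q` on `y = 0`. -/
theorem stmt16 (τL δL τR δR lamLs lamLu qL qR : ℝ)
    (hδL : 0 < δL) (hδR : 0 < δR)
    (hτL : τL > δL + 1) (hτR : τR < -(δR + 1))
    (hτL2 : τL > (δL + 2) / Real.sqrt 2) (hτR2 : τR < -((δR + 2) / Real.sqrt 2))
    (hlamLs : lamLs = (τL - Real.sqrt (τL ^ 2 - 4 * δL)) / 2)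
    (hlamLu : lamLu = (τL + Real.sqrt (τL ^ 2 - 4 * δL)) / 2)
    (hφ : 0 < δR - (τR + δL + δR - (1 + τR) * lamLu) * lamLu)
    (hqL : qL = -(τL / 2) * (1 - Real.sqrt (1 - 4 * δL / τL ^ 2)))
    (hqR : qR = -(τR / 2) * (1 - Real.sqrt (1 - 4 * δR / τR ^ 2)))
    (Y D S B : ℝ × ℝ)
    (hY : Y = (-1 / (τL - δL - 1), δL / (τL - δL - 1)))
    (hD : D = (1 / (1 - lamLs), 0))
    (hS : S = (0, -lamLu / (lamLu - 1)))
    (hB1 : B ∈ segment ℝ Y D)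
    (hB2 : (bcnf τL δL τR δR D).2 - B.2 = -lamLu * ((bcnf τL δL τR δR D).1 - B.1))
    (P₀ P₁ : ℝ × ℝ) (hP : P₀ ≠ P₁)
    (m : ℝ) (hm : m ∈ Set.Icc qL qR)
    (hslope : P₁.2 - P₀.2 = m * (P₁.1 - P₀.1))
    (hα : segment ℝ P₀ P₁ ⊆ convexHull ℝ {B, D, bcnf τL δL τR δR D}) :
    ∃ n : ℕ, 1 ≤ n ∧ ∃ P Q : ℝ × ℝ, P.1 = 0 ∧ Q.2 = 0 ∧
      segment ℝ P Q ⊆ (bcnf τL δL τR δR)^[n] '' segment ℝ P₀ P₁ := by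
  obtain ⟨hadd, hmul, hs0, hs1, hu⟩ := quadratic_roots_bounds hδL hτL hτL2 hlamLs hlamLu
  obtain ⟨haddR, hmulR, hsR0, -, huR⟩ := quadratic_roots_bounds (τ := -τR) hδR (by linarith)
    (by linarith) rfl rfl
  have hτL0 : 0 < τL := by linarith
  have hτR0 : 0 < -τR := by linarith
  have hqLs : qL = -lamLs := by
    rw [hqL, hlamLs, show 1 - 4 * δL / τL ^ 2 = (τL ^ 2 - 4 * δL) / τL ^ 2 by field_simp,
      Real.sqrt_div' _ (sq_nonneg _), Real.sqrt_sq hτL0.le]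
    field_simp
  have hqRs : qR = (-τR - √((-τR) ^ 2 - 4 * δR)) / 2 := by
    have hne : τR ≠ 0 := by linarith
    rw [hqR, show 1 - 4 * δR / τR ^ 2 = ((-τR) ^ 2 - 4 * δR) / (-τR) ^ 2 by field_simp,
      Real.sqrt_div' _ (sq_nonneg _), Real.sqrt_sq hτR0.le]
    field_simp
    ring
  rw [← hqRs] at haddR hmulR hsR0
  generalize (-τR + √((-τR) ^ 2 - 4 * δR)) / 2 = uR at haddR hmulR huR
  clear hqL hqR hlamLs hlamLu hqRs
  subst hqLs
  have h2 : 1 < √(2 : ℝ) := by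
    rw [Real.lt_sqrt] <;> norm_num
  have h22 : √(2 : ℝ) < 2 := by
    rw [Real.sqrt_lt'] <;> norm_num
  have hK : IsExpandingCone τL δL τR δR (-lamLs) qR (min (min lamLu uR) 2) := by
    refine ⟨fun m hm ↦ ?_, fun m hm ↦ ?_, ?_⟩
    · have hle : lamLu ≤ τL + m := by linarith [hm.1]
      have hpos : 0 < τL + m := by linarith
      refine ⟨(min_le_left _ _).trans ((min_le_left _ _).trans hle), ?_, ?_⟩
      · rw [le_div_iff₀ hpos]
        nlinarith
      · exact (div_nonpos_of_nonpos_of_nonneg (by linarith) hpos.le).trans hsR0.le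
    · have hle : uR ≤ -(τR + m) := by linarith [hm.2]
      have hpos : 0 < -(τR + m) := by linarith
      refine ⟨(min_le_left _ _).trans ((min_le_right _ _).trans hle), ?_⟩
      rw [← neg_div_neg_eq, neg_neg]
      constructor
      · exact le_trans (by linarith) (div_nonneg hδR.le hpos.le)
      · rw [div_le_iff₀ hpos]
        nlinarith
    · exact lt_min (lt_min (by linarith) (by linarith)) two_pos
  have hc2 : 2 < min (min lamLu uR) 2 ^ 2 := by
    have hlt : √2 < min (min lamLu uR) 2 := lt_min (lt_min hu huR) h22
    exact (Real.sqrt_lt' hK.pos).1 hlt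
  set d := 1 / (1 - lamLs) with hd
  have hds : d * (1 - lamLs) = 1 := by
    rw [hd]
    exact div_mul_cancel₀ _ (by linarith)
  have hd1 : 1 ≤ d := by nlinarith
  set k := δR / (lamLs - τR) with hk
  have hks : k * (lamLs - τR) = δR := div_mul_cancel₀ _ (by linarith)
  have hk0 : 0 < k := div_pos hδR (by linarith)
  obtain ⟨c, hc⟩ : ∃ c, c = lamLu * (τR * d + 1) - δR * d := ⟨_, rfl⟩
  have hc0 : 0 ≤ c * (lamLu - 1) + lamLu := by
    refine le_of_mul_le_mul_right ?_ (by linarith : 0 < 1 - lamLs)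
    rw [zero_mul, hc]
    refine hφ.le.trans_eq ?_
    rw [← hmul]
    linear_combination -(lamLu * τR - δR) * (lamLu - 1) * hds
  set T := trappingTriangle lamLs lamLu d k c
  have hT : MapsTo (bcnf τL δL τR δR) T T := by
    rw [← hadd, ← hmul]
    exact mapsTo_bcnf_trappingTriangle hs0 (by linarith) (by linarith) hδR (by linarith) hds hd1
      hks hc hc0
  have hDT : D ∈ T := by
    rw [hD]
    refine ⟨by simp, ?_, by simp⟩
    have : τR * d + 1 < 0 := by nlinarith
    simp only [hc]
    nlinarith
  have hfD : bcnf τL δL τR δR D = (τR * d + 1, -δR * d) := by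
    rw [hD, bcnf_of_nonneg (by simpa using hd1.trans' zero_le_one)]
    simp
  have hBT : B ∈ T := by
    rw [hfD] at hB2
    obtain ⟨a, b, ha, hb, hab, hB⟩ := hB1
    have hY' : Y.1 ≤ 0 ∧ 0 ≤ Y.2 ∧ lamLs * Y.1 + Y.2 = lamLs * d := by
      have hpos : 0 < τL - δL - 1 := by linarith
      rw [hY]
      refine ⟨div_nonpos_of_nonpos_of_nonneg (by norm_num) hpos.le, by positivity, ?_⟩
      have hfac : τL - δL - 1 = (1 - lamLs) * (lamLu - 1) := by
        linear_combination hmul - hadd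
      have hs : 1 - lamLs ≠ 0 := by linarith
      have hu' : lamLu - 1 ≠ 0 := by linarith
      rw [hfac, ← hmul, hd]
      field_simp
      ring
    have hB₁ : B.1 = a * Y.1 + b * d := by simp [← hB, hD]
    have hB₂ : B.2 = a * Y.2 := by simp [← hB, hD]
    refine ⟨le_of_eq ?_, le_of_eq ?_, ?_⟩
    · rw [hB₁, hB₂]
      linear_combination a * hY'.2.2 + lamLs * d * hab
    · rw [hc]
      linear_combination hB2
    · have : B.1 ≤ d := by
        rw [hB₁]
        linarith [mul_nonpos_of_nonneg_of_nonpos ha hY'.1,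
          mul_le_of_le_one_left (zero_le_one.trans hd1) (by linarith : b ≤ 1)]
      have : 0 ≤ B.2 := by
        rw [hB₂]
        exact mul_nonneg ha hY'.2.1
      exact (mul_nonpos_of_nonneg_of_nonpos hk0.le (by linarith)).trans this
  have hΩ : convexHull ℝ {B, D, bcnf τL δL τR δR D} ⊆ T :=
    convexHull_min (by simp [insert_subset_iff, hBT, hDT, hT hDT]) convex_trappingTriangle
  have hM : ∀ p ∈ T, ∀ q ∈ T, |q.1 - p.1| ≤ d - (c - lamLs * d) / (lamLu - lamLs) := by
    intro p hp q hq
    have hp' := fst_mem_Icc_of_mem_trappingTriangle hs0 (by linarith) hk0 hp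
    have hq' := fst_mem_Icc_of_mem_trappingTriangle hs0 (by linarith) hk0 hq
    rw [abs_le]
    constructor <;> linarith [hp'.1, hp'.2, hq'.1, hq'.2]
  have hne : P₀.1 ≠ P₁.1 := by
    intro h
    refine hP (Prod.ext h ?_)
    rw [h, sub_self, mul_zero, sub_eq_zero] at hslope
    exact hslope.symm
  exact IsConeSegment.reachesAxes hK (min_le_right _ _) hc2 hT convex_trappingTriangle hM
    ⟨hΩ (hα (left_mem_segment ℝ _ _)), hΩ (hα (right_mem_segment ℝ _ _)), hne, m, hm, hslope⟩
end
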